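/- For every s₁ with 0.295 ≤ s₁ ≤ √(8/5) and √(1 − T⁻¹(s₁)²) − s₁/2 ≤ s₁, the point (x₊₁, y₊₁) lies in the closed unit disk, i.e. x₊₁² + y₊₁² ≤ 1, where x₊₁ := s₁/2 + σ(s₁)/(2√2) and y₊₁ := T⁻¹(s₁) + σ(s₁) + σ(s₁)/(2√2) if s₁ ≤ s₁*, while y₊₁ := σ(s₁)/2 + σ(s₁)/(2√2) if s₁ > s₁*. -/

import Mathlib

noncomputable section

/-- T⁻¹(s) = √(1 − s²/4) − s. -/
def Tinv (s : ℝ) : ℝ := Real.sqrt (1 - s ^ 2 / 4) - s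

/-- T(u) = (2/5)(√(5 − u²) − 2u). -/
def Tfun (u : ℝ) : ℝ := 2 / 5 * (Real.sqrt (5 - u ^ 2) - 2 * u)

/-- s₁* = √((2 + √2)/3). -/
def s1star : ℝ := Real.sqrt ((2 + Real.sqrt 2) / 3)

/-- σ(s₁), the side length of the largest square fitting into a side pocket. -/
def sigma (s₁ : ℝ) : ℝ :=
  if s₁ ≤ s1star then
    1 / 4 * (-s₁ - 2 * Tinv s₁ + Real.sqrt (8 - (s₁ - 2 * Tinv s₁) ^ 2))
  else
    1 / 5 * (Real.sqrt (20 - s₁ ^ 2) - 2 * s₁)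

/-- w(y_t, h) = 2√(min{1 − y_t², 1 − (y_t − h)²}). -/
def wfun (yt h : ℝ) : ℝ := 2 * Real.sqrt (min (1 - yt ^ 2) (1 - (yt - h) ^ 2))

/-- X(a, b, u). -/
def Xfun (a b u : ℝ) : ℝ :=
  if u ≤ 2 * min a (-b) then Tinv u else Real.sqrt (1 - (u - min a (-b)) ^ 2) - u

/-- Y(a, h, w, h′) = w/2 − h + X(a, a − h, h′). -/
def Yfun (a h w h' : ℝ) : ℝ := w / 2 - h + Xfun a (a - h) h'

/-- B₁(h, w, h′). -/
def B1 (h w h' : ℝ) : ℝ :=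
  max (h * w / 2 + h ^ 2 / 4) (max (h ^ 2 + (w - h - h') * h') (h * (w + h) / 2 - h' ^ 2))

/-- B₂(h, w, h′). -/
def B2 (h w h' : ℝ) : ℝ :=
  if w < h + h' then h ^ 2
  else if w < 2 * h then h ^ 2 + h' ^ 2
  else B1 h w h'

/-- B₃(a, h, w, h′). -/
def B3 (a h w h' : ℝ) : ℝ :=
  max (h ^ 2 + max (Yfun a h w h') 0 * h')
      (h ^ 2 + min (max (Yfun a h w h') 0 ^ 2) (2 * h' ^ 2))

/-- B₄(a, h, w, h′). -/
def B4 (a h w h' : ℝ) : ℝ := max (B2 h w h') (B3 a h w h')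

/-- E(s₁, sₙ). -/
def Efun (s₁ sn : ℝ) : ℝ := if sn ≤ sigma s₁ then 0.83 * sigma s₁ ^ 2 else 0

/-- A(δ), the area of a circular segment of the unit disk of height δ. -/
def Aseg (δ : ℝ) : ℝ := Real.arccos (1 - δ) - (1 - δ) * Real.sqrt (1 - (1 - δ) ^ 2)

/-- B₅(h, H) = A(H − h) + h² − H·h. -/
def B5 (h H : ℝ) : ℝ := Aseg (H - h) + h ^ 2 - H * h

/-- B₆(H_R, W_R, h′) = H_R·W_R/2 + h′·H_R/4. -/
def B6 (HR WR h' : ℝ) : ℝ := HR * WR / 2 + h' * HR / 4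

/-- The width condition forces `s² ≥ 2/5`. -/
lemma two_fifths_le_sq_of_width_le {s : ℝ} (hs : 0 < s) (hs2 : s ^ 2 ≤ 8 / 5)
    (h : Real.sqrt (1 - Tinv s ^ 2) - s / 2 ≤ s) : 2 / 5 ≤ s ^ 2 := by
  have hc0 := Real.sqrt_nonneg (1 - s ^ 2 / 4)
  have hc2 : Real.sqrt (1 - s ^ 2 / 4) ^ 2 = 1 - s ^ 2 / 4 := Real.sq_sqrt (by linarith)
  have h1 : 1 - Tinv s ^ 2 ≤ (3 / 2 * s) ^ 2 :=
    (Real.sqrt_le_left (by positivity)).1 (by linarith)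
  rw [Tinv] at h1
  set c := Real.sqrt (1 - s ^ 2 / 4)
  have h2 : s * (2 * c) ≤ s * (3 * s) := by nlinarith
  have h3 : 2 * c ≤ 3 * s := le_of_mul_le_mul_left h2 hs
  nlinarith

lemma inv_two_sqrt_two_bounds :
    0.3535 ≤ 1 / (2 * Real.sqrt 2) ∧ 1 / (2 * Real.sqrt 2) ≤ 0.35356 := by
  have h1 : (1.4142 : ℝ) ≤ Real.sqrt 2 := Real.le_sqrt_of_sq_le (by norm_num)
  have h2 : Real.sqrt 2 ≤ 1.4143 := (Real.sqrt_le_left (by norm_num)).2 (by norm_num)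
  constructor
  · rw [le_div_iff₀ (by positivity)]; linarith
  · rw [div_le_iff₀ (by positivity)]; linarith

lemma sq_s1star_le : s1star ^ 2 ≤ 1.1381 := by
  have h2 : Real.sqrt 2 ≤ 1.4143 := (Real.sqrt_le_left (by norm_num)).2 (by norm_num)
  rw [s1star, Real.sq_sqrt (by positivity)]
  linarith

lemma le_s1star : 1.066 ≤ s1star := by
  have h1 : (1.4142 : ℝ) ≤ Real.sqrt 2 := Real.le_sqrt_of_sq_le (by norm_num)
  exact Real.le_sqrt_of_sq_le (by norm_num; linarith)

/-- The point lies in the disk when `s₁` is at most the threshold. -/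
lemma point_in_disk_of_le_s1star {s k : ℝ} (hk : 0.3535 ≤ k ∧ k ≤ 0.35356)
    (hs : 0.632 ≤ s) (hs' : s ≤ s1star) :
    (s / 2 + sigma s * k) ^ 2 + (Tinv s + sigma s + sigma s * k) ^ 2 ≤ 1 := by
  obtain ⟨hk1, hk2⟩ := hk
  have hs2 : s ^ 2 ≤ 1.1381 :=
    (pow_le_pow_left₀ (by linarith) hs' 2).trans sq_s1star_le
  have hsu : s ≤ 1.067 := by nlinarith
  have hc1 : 0.84 ≤ Real.sqrt (1 - s ^ 2 / 4) := Real.le_sqrt_of_sq_le (by linarith)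
  have hc2 : Real.sqrt (1 - s ^ 2 / 4) ≤ 0.949 :=
    (Real.sqrt_le_left (by norm_num)).2 (by nlinarith)
  have hg : sigma s = 1 / 4 * (-s - 2 * Tinv s + Real.sqrt (8 - (s - 2 * Tinv s) ^ 2)) :=
    if_pos hs'
  have hr0 := Real.sqrt_nonneg (8 - (s - 2 * Tinv s) ^ 2)
  have hr1 : Real.sqrt (8 - (s - 2 * Tinv s) ^ 2) ≤ 2.8286 :=
    (Real.sqrt_le_left (by norm_num)).2 (by nlinarith [sq_nonneg (s - 2 * Tinv s)])
  have hT : Tinv s = Real.sqrt (1 - s ^ 2 / 4) - s := rfl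
  generalize Real.sqrt (8 - (s - 2 * Tinv s) ^ 2) = r at *
  generalize sigma s = g at *
  generalize Tinv s = t at *
  generalize Real.sqrt (1 - s ^ 2 / 4) = c at *
  have hgl : -0.32 ≤ g := by linarith
  have hkl : -0.1132 ≤ g * k := by nlinarith
  have hku : g * k ≤ 0.35356 * (0.70715 - c / 2 + s / 4) := by
    have h1 : g ≤ 0.70715 - c / 2 + s / 4 := by linarith
    have h2 : g * k ≤ (0.70715 - c / 2 + s / 4) * k :=
      mul_le_mul_of_nonneg_right h1 (by linarith)
    nlinarith
  have hx0 : 0 ≤ s / 2 + g * k := by linarith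
  have hx : s / 2 + g * k ≤ 0.1016 + 0.5885 * s := by linarith
  have hy : t + g + g * k ≤ 1.2645 - 0.6615 * s := by linarith
  have hy0 : -0.67 ≤ t + g + g * k := by linarith
  have hx2 := pow_le_pow_left₀ hx0 hx 2
  rcases le_total 0 (t + g + g * k) with h | h
  · have hy2 := pow_le_pow_left₀ h hy 2
    nlinarith [mul_nonneg (sub_nonneg.2 hs) (sub_nonneg.2 hsu)]
  · have hy2 : (t + g + g * k) ^ 2 ≤ 0.67 ^ 2 := by
      rw [← neg_sq]; exact pow_le_pow_left₀ (by linarith) (by linarith) 2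
    have hx3 := pow_le_pow_left₀ hx0 (show s / 2 + g * k ≤ 0.74 by linarith) 2
    linarith

/-- The point lies in the disk when `s₁` exceeds the threshold. -/
lemma point_in_disk_of_s1star_lt {s k : ℝ} (hk : 0.3535 ≤ k ∧ k ≤ 0.35356)
    (hs : s1star < s) (hs' : s ≤ 1.265) :
    (s / 2 + sigma s * k) ^ 2 + (sigma s / 2 + sigma s * k) ^ 2 ≤ 1 := by
  obtain ⟨hk1, hk2⟩ := hk
  have hsl : 1.066 ≤ s := le_s1star.trans hs.le
  have hg : sigma s = 1 / 5 * (Real.sqrt (20 - s ^ 2) - 2 * s) := if_neg (not_le.2 hs)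
  have hr1 : 4.2 ≤ Real.sqrt (20 - s ^ 2) := Real.le_sqrt_of_sq_le (by nlinarith)
  have hr2 : Real.sqrt (20 - s ^ 2) ≤ 4.35 :=
    (Real.sqrt_le_left (by norm_num)).2 (by nlinarith)
  generalize Real.sqrt (20 - s ^ 2) = r at *
  generalize sigma s = g at *
  have hg0 : 0 ≤ g := by linarith
  have hku : g * k ≤ 0.35356 * g := by nlinarith
  have hk0 : 0 ≤ g * k := mul_nonneg hg0 (by linarith)
  have hx := pow_le_pow_left₀ (by linarith)
    (show s / 2 + g * k ≤ 0.77 by linarith) 2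
  have hy := pow_le_pow_left₀ (by linarith)
    (show g / 2 + g * k ≤ 0.4 by linarith) 2
  linarith

theorem top_packing_point_one_in_disk (s₁ : ℝ)
    (h₁ : 0.295 ≤ s₁) (h₂ : s₁ ≤ Real.sqrt (8 / 5))
    (hℓ : Real.sqrt (1 - Tinv s₁ ^ 2) - s₁ / 2 ≤ s₁) :
    (s₁ / 2 + sigma s₁ / (2 * Real.sqrt 2)) ^ 2 +
      (if s₁ ≤ s1star then Tinv s₁ + sigma s₁ + sigma s₁ / (2 * Real.sqrt 2)
       else sigma s₁ / 2 + sigma s₁ / (2 * Real.sqrt 2)) ^ 2 ≤ 1 := by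
  have hs0 : 0 < s₁ := by linarith
  have hsq : s₁ ^ 2 ≤ 8 / 5 := (Real.le_sqrt hs0.le (by norm_num)).1 h₂
  have hlow := two_fifths_le_sq_of_width_le hs0 hsq hℓ
  have hdiv : sigma s₁ / (2 * Real.sqrt 2) = sigma s₁ * (1 / (2 * Real.sqrt 2)) :=
    div_eq_mul_one_div _ _
  rw [hdiv]
  split_ifs with h
  · exact point_in_disk_of_le_s1star inv_two_sqrt_two_bounds (by nlinarith) h
  · exact point_in_disk_of_s1star_lt inv_two_sqrt_two_bounds (not_le.1 h) (by nlinarith)
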